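/- Fix m ≥ 1 and suppose δ^(m) : ℤ_{≥m} → ℝ is such that for each n ≥ m, the set {p ≥ 1 : A^(m)(p) = n} has asymptotic density δ^(m)(n) (such densities exist). Then Σ_{n=m}^∞ δ^(m)(n) = 1, and A^(m) has a mean value equal to Σ_{n=m}^∞ n·δ^(m)(n): the series Σ_{n=m}^∞ n·δ^(m)(n) converges and (1/N)·Σ_{i=1}^N A^(m)(i) → Σ_{n=m}^∞ n·δ^(m)(n) as N → ∞. -/

import Mathlib

open List Filter

open scoped Classical

noncomputable section

/-- The curling number of a finite string: the largest `k` such that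
`S = X ++ Y^k` with `Y` nonempty; by convention `curl [] = 1`. -/
def curl (S : List ℕ) : ℕ :=
  max 1 (sSup {k | ∃ X Y : List ℕ, Y ≠ [] ∧ S = X ++ (List.replicate k Y).flatten})

/-- The prefix of length `n` of the level-`m` Gijswijt sequence `A^(m)`. -/
def gPrefix (m : ℕ) : ℕ → List ℕ
  | 0 => []
  | n + 1 => gPrefix m n ++ [max m (curl (gPrefix m n))]

/-- `gij m p` is the `p`-th term (1-indexed) of the level-`m` Gijswijt sequence `A^(m)`. -/
def gij (m p : ℕ) : ℕ := max m (curl (gPrefix m (p - 1)))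

/-- Standing hypothesis: for every `m ≥ 1`, the sets
`{k ≥ 0 : C(A^(m)[1,k]) ≤ m}` and `{k ≥ 0 : C(A^(m+1)[1,k]) ≤ m}` are infinite. -/
def StandingHyp : Prop :=
  ∀ m : ℕ, 1 ≤ m →
    {k : ℕ | curl (gPrefix m k) ≤ m}.Infinite ∧
    {k : ℕ | curl (gPrefix (m + 1) k) ≤ m}.Infinite

/-- Length of `π^(m)(1,x)`: the `x`-th smallest (0-indexed) element of
`{k : C(A^(m)[1,k]) ≤ m}`. -/
def piLen (m x : ℕ) : ℕ := Nat.nth (fun k => curl (gPrefix m k) ≤ m) x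

/-- `π^(m)(1,x)`: the prefix of `A^(m)` with exactly `x` occurrences of `m`
and curling number at most `m`. -/
def piStr (m x : ℕ) : List ℕ := gPrefix m (piLen m x)

/-- `β^(m)(t)`, the length of `B_t^(m)`. -/
def beta (m t : ℕ) : ℕ := piLen m ((m + 1) ^ (t - 1))

/-- `B_t^(m) := π^(m)(1,(m+1)^(t-1))`. -/
def Bstr (m t : ℕ) : List ℕ := piStr m ((m + 1) ^ (t - 1))

/-- `τ^(m)(t)`, the length of `T_t^(m)`. -/
def tau (m t : ℕ) : ℕ := Nat.nth (fun k => curl (gPrefix (m + 1) k) ≤ m) (t - 1)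

/-- `T_t^(m)`: the `t`-th shortest prefix of `A^(m+1)` with curling number at most `m`. -/
def Tstr (m t : ℕ) : List ℕ := gPrefix (m + 1) (tau m t)

/-- `φ^(m)(n)`: the least `p ≥ 1` with `A^(m)(p) = n`. -/
def phi (m n : ℕ) : ℕ := sInf {p : ℕ | 1 ≤ p ∧ gij m p = n}

/-- `t^(m)(n) = 1 + log_{m+1} #\{i ≤ φ^(m)(n) : A^(m)(i) = m\}`. -/
def tfun (m n : ℕ) : ℕ := 1 + Nat.log (m + 1) ((gPrefix m (phi m n)).count m)

/-- `χ^(b)(a)`: read the base-`b` digits of `a` as base-`(b+1)` digits. -/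
def chi (b a : ℕ) : ℕ := Nat.ofDigits (b + 1) (Nat.digits b a)

/-- `ι_m(t)`: read the base-`(m+2)` digits of the number of occurrences of `m+1`
in `T_t^(m)` as base-`(m+1)` digits. -/
def iota (m t : ℕ) : ℕ :=
  Nat.ofDigits (m + 1) (Nat.digits (m + 2) ((Tstr m t).count (m + 1)))

/-- `ι_m⁻¹(p)`: the largest `x ≥ 1` with `ι_m(x) ≤ p`. -/
def iotaInv (m p : ℕ) : ℕ := sSup {x : ℕ | 1 ≤ x ∧ iota m x ≤ p}

/-- `ord_b(n)`: the `b`-adic valuation of `n`. -/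
def ordb (b n : ℕ) : ℕ := sSup {z : ℕ | b ^ z ∣ n}

/-- The largest base-`b` digit of `n`. -/
def maxdigit (b n : ℕ) : ℕ := (Nat.digits b n).foldr max 0

/-- Auxiliary function for the level-`m` expansion: `lexpAux m a k = a_{m+1+k}`. -/
def lexpAux (m a : ℕ) : ℕ → ℕ
  | 0 => a
  | k + 1 => iota (m + 1 + k) (ordb (m + 1 + k) (lexpAux m a k) + 1)

/-- `lexp m a l = a_l`, the `l`-th term of the level-`m` expansion of `a`. -/
def lexp (m a l : ℕ) : ℕ := lexpAux m a (l - (m + 1))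

/-- The last element `n` of `π^(m+1)(1, χ^(m+1)(a))`; the level-`m` expansion
of `a` is `a_{m+1}, …, a_n`. -/
def levelEnd (m a : ℕ) : ℕ := (piStr (m + 1) (chi (m + 1) a)).getLastD 0

/-- `V_m := {v ≥ 0 : C(T_{v+1}^(m+1)) ≤ m}`. -/
def Vset (m : ℕ) : Set ℕ := {v | curl (Tstr (m + 1) (v + 1)) ≤ m}

/-- `Q := {α ≥ 0 : C(T_{α+1}^(2)) = 1}`. -/
def Qset : Set ℕ := {a | curl (Tstr 2 (a + 1)) = 1}

/-- `R := {(a,b) : a ∈ Q, a < b, no suffix S of T_{a+1}^(2) with T_{a+1}^(2)·S = T_{b+1}^(2)}`. -/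
def Rset : Set (ℕ × ℕ) :=
  {p | p.1 ∈ Qset ∧ p.1 < p.2 ∧
    ¬∃ S : List ℕ, S <:+ Tstr 2 (p.1 + 1) ∧ Tstr 2 (p.1 + 1) ++ S = Tstr 2 (p.2 + 1)}

/-- The digit of `x` in base `b` at (1-indexed) position `i`, i.e. the coefficient
of `b^(i-1)`. -/
def digitAt (b x i : ℕ) : ℕ := (Nat.digits b x).getD (i - 1) 0

/-- `u` is the (1-indexed) position of the second nonzero base-`b` digit of `x`
(the first nonzero digit being at position `ord_b(x)+1`). -/
def IsSecondNonzero (b x u : ℕ) : Prop :=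
  ordb b x + 1 < u ∧ digitAt b x u ≠ 0 ∧
    ∀ i, ordb b x + 1 < i → i < u → digitAt b x i = 0

/-- `𝒮_b`: pairs `(a,a')` with `1 ≤ a < a'` such that for some position `y` the
base-`b` digits of `a` and `a'` agree away from `y` and twice the `y`-th digit of `a`
is at least the `y`-th digit of `a'`. -/
def Sset (b : ℕ) : Set (ℕ × ℕ) :=
  {p | 1 ≤ p.1 ∧ p.1 < p.2 ∧
    ∃ y : ℕ, (∀ i, i ≠ y → (Nat.digits b p.1).getD i 0 = (Nat.digits b p.2).getD i 0) ∧
      (Nat.digits b p.2).getD y 0 ≤ 2 * (Nat.digits b p.1).getD y 0}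

/-- The glue string `S_t^(m)`, so that `T_{t+1}^(m) = T_t^(m) ++ glue m t`. -/
def glue (m t : ℕ) : List ℕ := (gPrefix (m + 1) (tau m (t + 1))).drop (tau m t)

/-- The strings `P_t^(m)`: `P_1^(m) = (m)` and `P_{t+1}^(m) = P_t^(m)·B_t^(m)·S_t^(m)`. -/
def Pstr (m : ℕ) : ℕ → List ℕ
  | 0 => []
  | 1 => [m]
  | t + 2 => Pstr m (t + 1) ++ Bstr m (t + 1) ++ glue m (t + 1)

end

/-- The terms of the level-`m` Gijswijt sequence, indexed from `0`. -/
noncomputable def gseq (m q : ℕ) : ℕ := max m (curl (gPrefix m q))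

/-- The length-`p` prefix of `a` ends in `k` copies of a string of length `y`. -/
def EndsInPower (a : ℕ → ℕ) (p y k : ℕ) : Prop :=
  1 ≤ y ∧ k * y ≤ p ∧ ∀ i, p ≤ i + k * y → i + y < p → a i = a (i + y)

theorem gPrefix_eq_map (m n : ℕ) : gPrefix m n = (List.range n).map (gseq m) := by
  induction n with
  | zero => rfl
  | succ n ih => rw [List.range_succ, List.map_append, ← ih]; rfl

theorem EndsInPower.mono {a : ℕ → ℕ} {p y k k' : ℕ} (h : EndsInPower a p y k) (hk : k' ≤ k) :
    EndsInPower a p y k' := by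
  obtain ⟨hy, hp, h⟩ := h
  have hle : k' * y ≤ k * y := Nat.mul_le_mul_right y hk
  exact ⟨hy, hle.trans hp, fun i hi => h i (by omega)⟩

theorem EndsInPower.of_append {a : ℕ → ℕ} {p k : ℕ} {X Y : List ℕ} (hY : Y ≠ [])
    (h : (List.range p).map a = X ++ (List.replicate k Y).flatten) :
    EndsInPower a p Y.length k := by
  have hlen : p = X.length + k * Y.length := by
    simpa using congrArg List.length h
  have hY' : 1 ≤ Y.length := List.length_pos_iff.mpr hY
  refine ⟨hY', by omega, fun i hi hip => ?_⟩
  obtain ⟨j, rfl⟩ : ∃ j, i = X.length + j := ⟨i - X.length, by omega⟩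
  obtain _ | k := k
  · simp at hlen; omega
  have hj : j < k * Y.length := by
    have : (k + 1) * Y.length = k * Y.length + Y.length := by ring
    omega
  set W := (List.replicate k Y).flatten with hW
  have hWl : W.length = k * Y.length := by simp [hW]
  have h1 : (List.range p).map a = X ++ (W ++ Y) := by
    rw [h, List.replicate_succ', List.flatten_append]; simp [hW]
  have h2 : (List.range p).map a = X ++ (Y ++ W) := by
    rw [h, List.replicate_succ, List.flatten_cons]
  have e1 : ((List.range p).map a)[X.length + j]? = W[j]? := by
    rw [h1, List.getElem?_append_right (by omega), List.getElem?_append_left (by omega)]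
    congr 1; omega
  have e2 : ((List.range p).map a)[X.length + j + Y.length]? = W[j]? := by
    rw [h2, List.getElem?_append_right (by omega), List.getElem?_append_right (by omega)]
    congr 1; omega
  have e3 := e1.trans e2.symm
  rw [List.getElem?_map, List.getElem?_map, List.getElem?_range (by omega),
    List.getElem?_range hip] at e3
  simpa using e3

theorem EndsInPower.exists_append {a : ℕ → ℕ} {p y k : ℕ} (h : EndsInPower a p y k) :
    (List.range p).map a = (List.range (p - k * y)).map a ++
      (List.replicate k ((List.range y).map fun i => a (p - y + i))).flatten := by
  induction k with
  | zero => simp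
  | succ k ih =>
    have hs : (k + 1) * y = k * y + y := by ring
    have hp := h.2.1
    rw [ih (h.mono k.le_succ), List.replicate_succ, List.flatten_cons, ← List.append_assoc]
    congr 1
    have hr : List.range (p - k * y) = List.range (p - (k + 1) * y) ++
        (List.range y).map (p - (k + 1) * y + ·) := by
      rw [← List.range_add]; congr 1; omega
    rw [hr, List.map_append, List.map_map]
    congr 1
    apply List.map_congr_left
    intro i hi
    rw [List.mem_range] at hi
    have key : ∀ j, j ≤ k → a (p - (k + 1) * y + i) = a (p - (k + 1) * y + i + j * y) := by
      intro j
      induction j with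
      | zero => simp
      | succ j ihj =>
        intro hj
        have hjs : (j + 1) * y = j * y + y := by ring
        have : (j + 1) * y ≤ k * y := Nat.mul_le_mul_right y hj
        rw [ihj (by omega), h.2.2 (p - (k + 1) * y + i + j * y) (by omega) (by omega)]
        congr 1; omega
    rw [Function.comp_apply, key k le_rfl]
    congr 1; omega

theorem le_curl_iff {a : ℕ → ℕ} {p k : ℕ} (hk : 2 ≤ k) :
    k ≤ curl ((List.range p).map a) ↔ ∃ y, EndsInPower a p y k := by
  have hbdd : BddAbove {k | ∃ X Y : List ℕ, Y ≠ [] ∧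
      (List.range p).map a = X ++ (List.replicate k Y).flatten} := by
    refine ⟨p, ?_⟩
    rintro k ⟨X, Y, hY, h⟩
    obtain ⟨h1, h2, -⟩ := EndsInPower.of_append hY h
    nlinarith
  constructor
  · intro h
    have h' := (le_max_iff.mp h).resolve_left (by omega)
    have hne : {k | ∃ X Y : List ℕ, Y ≠ [] ∧
        (List.range p).map a = X ++ (List.replicate k Y).flatten}.Nonempty :=
      ⟨0, (List.range p).map a, [0], by simp, by simp⟩
    obtain ⟨X, Y, hY, he⟩ := Nat.sSup_mem hne hbdd
    exact ⟨_, (EndsInPower.of_append hY he).mono h'⟩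
  · rintro ⟨y, h⟩
    refine le_max_of_le_right (le_csSup hbdd ⟨_, _, ?_, h.exists_append⟩)
    have := h.1
    rw [Ne, ← List.length_eq_zero_iff]
    simp
    omega

theorem le_curl_gPrefix_iff {m p k : ℕ} (hk : 2 ≤ k) :
    k ≤ curl (gPrefix m p) ↔ ∃ y, EndsInPower (gseq m) p y k := by
  rw [gPrefix_eq_map, le_curl_iff hk]

theorem curl_gPrefix_le (m p : ℕ) : curl (gPrefix m p) ≤ p + 1 := by
  by_contra! h
  obtain ⟨y, h1, h2, -⟩ := (le_curl_gPrefix_iff (k := p + 2) (by omega)).mp h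
  nlinarith

theorem multiplicity_base_mul {b n : ℕ} (hb : 2 ≤ b) (hn : 0 < n) :
    multiplicity b (b * n) = multiplicity b n + 1 := by
  have hf : FiniteMultiplicity b n := Nat.finiteMultiplicity_iff.mpr ⟨by omega, hn⟩
  have hf' : FiniteMultiplicity b (b * n) :=
    Nat.finiteMultiplicity_iff.mpr ⟨by omega, by positivity⟩
  refine multiplicity_eq_of_dvd_of_not_dvd ?_ ?_
  · rw [pow_succ']
    exact mul_dvd_mul_left b (pow_multiplicity_dvd b n)
  · rw [pow_succ' b (multiplicity b n + 1)]
    intro h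
    exact hf.not_pow_dvd_of_multiplicity_lt (Nat.lt_succ_self _)
      (Nat.dvd_of_mul_dvd_mul_left (by omega) h)

/-- The `b`-adic valuation is `c`-periodic on the `K * c` integers preceding `x`. -/
def PeriodicBefore (b x c K : ℕ) : Prop :=
  1 ≤ c ∧ K * c < x ∧
    ∀ z, x ≤ z + K * c → z + c < x → multiplicity b z = multiplicity b (z + c)

theorem PeriodicBefore.dvd_period {b x c K z : ℕ} (hK : 2 ≤ K)
    (h : PeriodicBefore b x c K) (hz : x ≤ z + K * c) (hzx : z < x) (hd : b ∣ z) : b ∣ c := by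
  obtain ⟨hc, hx, h⟩ := h
  by_cases hzc : z + c < x
  · have := dvd_iff_multiplicity_pos.mpr hd
    rw [h z hz hzc] at this
    exact (Nat.dvd_add_right hd).mp (dvd_iff_multiplicity_pos.mp this)
  · have h2 : 2 * c ≤ K * c := Nat.mul_le_mul_right c hK
    have := h (z - c) (by omega) (by omega)
    rw [Nat.sub_add_cancel (by omega)] at this
    have hd' := dvd_iff_multiplicity_pos.mpr hd
    rw [← this] at hd'
    have := dvd_iff_multiplicity_pos.mp hd'
    have h3 := Nat.dvd_sub hd this
    rwa [show z - (z - c) = c by omega] at h3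

/-- Dividing a window with period `b * c` by `b` keeps the valuation periodic. -/
theorem PeriodicBefore.div {b x c K : ℕ} (hb : 2 ≤ b)
    (h : PeriodicBefore b (x + 1) (b * c) K) : PeriodicBefore b (x / b + 1) c K := by
  obtain ⟨hc, hx, h⟩ := h
  have hb0 : 0 < b := by omega
  have key : ∀ w, w < x / b + 1 ↔ b * w < x + 1 := by
    intro w
    rw [Nat.lt_succ_iff, Nat.lt_succ_iff, Nat.le_div_iff_mul_le hb0, mul_comm]
  have e : K * (b * c) = b * (K * c) := by ring
  have hcp : 1 ≤ c := Nat.pos_of_mul_pos_left hc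
  refine ⟨hcp, (key _).mpr (by omega), fun z hz hzc => ?_⟩
  have h1 : x + 1 ≤ b * z + K * (b * c) := by
    rw [e, ← mul_add]
    by_contra! hlt
    exact absurd ((key _).mpr hlt) (by omega)
  have h2 : b * z + b * c < x + 1 := by
    rw [← mul_add]; exact (key _).mp hzc
  have := h (b * z) h1 h2
  have hzpos : 0 < z := by
    have := (key (K * c)).mpr (by omega)
    omega
  rw [← mul_add, multiplicity_base_mul hb hzpos, multiplicity_base_mul hb (by omega)] at this
  omega

theorem exists_dvd_of_le {b x L : ℕ} (hb : 0 < b) (hL : b ≤ L) :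
    ∃ z, x < z + L ∧ z ≤ x ∧ b ∣ z := by
  refine ⟨b * (x / b), ?_, Nat.mul_div_le x b, dvd_mul_right _ _⟩
  have := Nat.lt_mul_div_succ x hb
  rw [mul_add] at this
  omega

/-- A window of at least two periods has fewer than `b` periods, and with `b - 1` of them its
last element has a base-`b` digit `b - 1`. -/
theorem PeriodicBefore.lt_base {b K : ℕ} (hb : 2 ≤ b) (hK : 2 ≤ K) :
    ∀ {c x : ℕ}, PeriodicBefore b (x + 1) c K →
      K < b ∧ (b ≤ K + 1 → ∃ i, x / b ^ i % b = b - 1) := by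
  intro c
  induction c using Nat.strong_induction_on with
  | _ c ih =>
    intro x h
    by_cases hex : ∃ z, x + 1 ≤ z + K * c ∧ z < x + 1 ∧ b ∣ z
    · obtain ⟨z, hz, hzx, hd⟩ := hex
      obtain ⟨c', rfl⟩ := h.dvd_period hK hz hzx hd
      have hc := h.1
      have hc' : 0 < c' := Nat.pos_of_mul_pos_left hc
      obtain ⟨h1, h2⟩ := ih c' (by nlinarith) (h.div hb)
      refine ⟨h1, fun hKb => ?_⟩
      obtain ⟨i, hi⟩ := h2 hKb
      exact ⟨i + 1, by rwa [pow_succ', ← Nat.div_div_eq_div_mul]⟩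
    · obtain ⟨hc, hx, -⟩ := h
      have hlt : K * c < b := by
        by_contra! hle
        obtain ⟨z, h1, h2, h3⟩ := exists_dvd_of_le (x := x) (by omega) hle
        exact hex ⟨z, h1, by omega, h3⟩
      have hKc : K ≤ K * c := Nat.le_mul_of_pos_right K hc
      refine ⟨by omega, fun hKb => ⟨0, ?_⟩⟩
      rw [pow_zero, Nat.div_one]
      by_contra hne
      have hmod := Nat.mod_lt x (show 0 < b by omega)
      have hdm := Nat.div_add_mod x b
      exact hex ⟨b * (x / b), by omega, by omega, dvd_mul_right _ _⟩

theorem PeriodicBefore.multiplicity_le {b K : ℕ} (hb : 2 ≤ b) (hK : 2 ≤ K) :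
    ∀ {c x : ℕ}, PeriodicBefore b x c K → multiplicity b (x - c) ≤ multiplicity b x := by
  intro c
  induction c using Nat.strong_induction_on with
  | _ c ih =>
    intro x h
    have h2 : 2 * c ≤ K * c := Nat.mul_le_mul_right c hK
    obtain ⟨hc, hx, hper⟩ := id h
    by_cases hd : b ∣ x - c
    · obtain ⟨c', rfl⟩ := h.dvd_period hK (z := x - c) (by omega) (by omega) hd
      have hdx : b ∣ x := by
        have := Nat.dvd_add hd (dvd_mul_right b c')
        rwa [Nat.sub_add_cancel (by omega)] at this
      obtain ⟨x', rfl⟩ := hdx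
      have hc' : 0 < c' := Nat.pos_of_mul_pos_left hc
      have hx' : c' < x' := by
        refine Nat.lt_of_mul_lt_mul_left (a := b) ?_
        omega
      have e : K * (b * c') = b * (K * c') := by ring
      have hP : PeriodicBefore b x' c' K := by
        refine ⟨hc', Nat.lt_of_mul_lt_mul_left (a := b) (by omega), fun z hz hzc => ?_⟩
        have hzpos : 0 < z := by
          have : K * c' < x' := Nat.lt_of_mul_lt_mul_left (a := b) (by omega)
          omega
        have := hper (b * z) (by rw [e, ← mul_add]; exact Nat.mul_le_mul_left b hz)
          (by rw [← mul_add]; exact Nat.mul_lt_mul_of_pos_left hzc (by omega))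
        rw [← mul_add, multiplicity_base_mul hb hzpos, multiplicity_base_mul hb (by omega)] at this
        omega
      have := ih c' (by nlinarith) hP
      rw [← Nat.mul_sub, multiplicity_base_mul hb (by omega), multiplicity_base_mul hb (by omega)]
      omega
    · rw [multiplicity_eq_zero.mpr hd]
      omega

theorem multiplicity_sub_two_mul {b : ℕ} (hb : 2 ≤ b) :
    ∀ {c x : ℕ}, 2 * c < x → multiplicity b x < multiplicity b (x - c) →
      multiplicity b (x - 2 * c) = multiplicity b x := by
  intro c x
  induction x using Nat.strong_induction_on generalizing c with
  | _ x ih =>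
    intro hx hlt
    have hd : b ∣ x - c := dvd_iff_multiplicity_pos.mp (by omega)
    by_cases hdx : b ∣ x
    · have hdc : b ∣ c := by
        have := Nat.dvd_sub hdx hd
        rwa [show x - (x - c) = c by omega] at this
      obtain ⟨c, rfl⟩ := hdc
      obtain ⟨x, rfl⟩ := hdx
      have e : 2 * (b * c) = b * (2 * c) := by ring
      have hx' : 2 * c < x := Nat.lt_of_mul_lt_mul_left (a := b) (by omega)
      rw [← Nat.mul_sub, multiplicity_base_mul hb (by omega),
        multiplicity_base_mul hb (by omega)] at hlt
      have := ih x (by nlinarith) hx' (by omega)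
      rw [e, ← Nat.mul_sub, multiplicity_base_mul hb (by omega),
        multiplicity_base_mul hb (by omega), this]
    · rw [multiplicity_eq_zero.mpr hdx, multiplicity_eq_zero]
      intro hd2
      have h1 := Nat.dvd_sub hd hd2
      rw [show x - c - (x - 2 * c) = c by omega] at h1
      apply hdx
      have := Nat.dvd_add hd h1
      rwa [Nat.sub_add_cancel (by omega)] at this

section Window

variable {a P : ℕ → ℕ} {m n c y lo : ℕ}

/-- If `a` is `y`-periodic on a stretch ending at a marked position, then the marked positions
in this stretch (those where `a` takes the value `m`) are shifted by `c` marks. -/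
theorem mark_sub_add (hP : StrictMono P) (hP0 : P 0 = 0)
    (hm : ∀ q < P n, (a q = m ↔ ∃ j, P j = q)) (hc : c ≤ n)
    (hcn : P (n - c) + y = P n) (hper : ∀ i, lo ≤ i → i + y < P n → a i = a (i + y)) :
    ∀ i ≤ n, lo + y ≤ P (n - i) → c ≤ n - i ∧ P (n - i - c) + y = P (n - i) := by
  intro i
  induction i with
  | zero => intro _ _; exact ⟨hc, hcn⟩
  | succ i ih =>
    intro hi hlo
    have hlt : P (n - (i + 1)) < P (n - i) := hP (by omega)
    obtain ⟨h1, h2⟩ := ih (by omega) (by omega)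
    have hle : P (n - i) ≤ P n := hP.monotone (by omega)
    have hne : c ≠ n - i := by
      rintro rfl
      rw [Nat.sub_self, hP0] at h2
      omega
    refine ⟨by omega, ?_⟩
    have e : a (P (n - (i + 1)) - y) = m := by
      rw [hper _ (by omega) (by omega), Nat.sub_add_cancel (by omega)]
      exact (hm _ (by omega)).mpr ⟨_, rfl⟩
    obtain ⟨j, hj⟩ := (hm _ (by omega)).mp e
    have hj1 : j < n - i - c := hP.lt_iff_lt.mp (by omega)
    have hj2 : ¬ j < n - (i + 1) - c := by
      intro hlt2
      have h3 : P j < P (n - (i + 1) - c) := hP hlt2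
      have h4 : P (n - (i + 1) - c) < P (n - i - c) := hP (by omega)
      have h5 := (hm (P (n - (i + 1) - c)) (by omega)).mpr ⟨_, rfl⟩
      rw [hper _ (by omega) (by omega)] at h5
      obtain ⟨j', hj'⟩ := (hm _ (by omega)).mp h5
      have h6 : n - (i + 1) < j' := hP.lt_iff_lt.mp (by omega)
      have h7 : j' < n - i := hP.lt_iff_lt.mp (by omega)
      omega
    have : j = n - (i + 1) - c := by omega
    subst this
    omega

theorem mark_add_of_periodic {K : ℕ} (hP : StrictMono P) (hP0 : P 0 = 0)
    (hm : ∀ q < P n, (a q = m ↔ ∃ j, P j = q)) (hc : c ≤ n)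
    (hcn : P (n - c) + y = P n) (hper : ∀ i, lo ≤ i → i + y < P n → a i = a (i + y))
    (hlo : lo + K * y ≤ P n) :
    K * c ≤ n ∧ ∀ z, n ≤ z + K * c → z + c ≤ n → P (z + c) = P z + y := by
  have main := mark_sub_add hP hP0 hm hc hcn hper
  have hE : ∀ j, j ≤ K → j * c ≤ n ∧ P (n - j * c) + j * y = P n := by
    intro j
    induction j with
    | zero => simp
    | succ j ih =>
      intro hj
      obtain ⟨h1, h2⟩ := ih (by omega)
      have e1 : (j + 1) * y = j * y + y := by ring
      have e2 : (j + 1) * c = j * c + c := by ring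
      have e3 : (j + 1) * y ≤ K * y := Nat.mul_le_mul_right y hj
      obtain ⟨h3, h4⟩ := main (j * c) h1 (by omega)
      rw [Nat.sub_sub, ← e2] at h4
      exact ⟨by omega, by omega⟩
  refine ⟨(hE K le_rfl).1, fun z hz hzc => ?_⟩
  obtain _ | K := K
  · have hc0 : c = 0 := by omega
    subst hc0
    simp only [Nat.sub_zero] at hcn
    simp; omega
  obtain ⟨h1, h2⟩ := hE K (by omega)
  have e1 : (K + 1) * y = K * y + y := by ring
  have e2 : (K + 1) * c = K * c + c := by ring
  have h3 : P (n - K * c) ≤ P (z + c) := hP.monotone (by omega)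
  have h4 := (main (n - (z + c)) (by omega)
    (by rw [Nat.sub_sub_self hzc]; omega)).2
  rw [Nat.sub_sub_self hzc, Nat.add_sub_cancel] at h4
  exact h4.symm

end Window

/-- The starting positions of the blocks `m T` of a sequence, where the `n`-th block (from `1`)
contains a string `T` of length `t v`, with `v` the `b`-adic valuation of `n`. -/
noncomputable def blockStart (b : ℕ) (t : ℕ → ℕ) : ℕ → ℕ
  | 0 => 0
  | n + 1 => blockStart b t n + 1 + t (multiplicity b (n + 1))

theorem blockStart_strictMono (b : ℕ) (t : ℕ → ℕ) : StrictMono (blockStart b t) :=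
  strictMono_nat_of_lt_succ fun n => by rw [blockStart]; omega

theorem exists_block (b : ℕ) (t : ℕ → ℕ) (q : ℕ) :
    ∃ n, q = blockStart b t n ∨
      ∃ i < t (multiplicity b (n + 1)), q = blockStart b t n + 1 + i := by
  induction q with
  | zero => exact ⟨0, Or.inl rfl⟩
  | succ q ih =>
    have key : ∀ n l, l ≤ t (multiplicity b (n + 1)) →
        ∃ n', blockStart b t n + 1 + l = blockStart b t n' ∨
        ∃ i < t (multiplicity b (n' + 1)), blockStart b t n + 1 + l = blockStart b t n' + 1 + i := by
      intro n l hl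
      rcases hl.lt_or_eq with h | rfl
      · exact ⟨n, Or.inr ⟨l, h, rfl⟩⟩
      · exact ⟨n + 1, Or.inl rfl⟩
    obtain ⟨n, rfl | ⟨i, hi, rfl⟩⟩ := ih
    · exact key n 0 (Nat.zero_le _)
    · exact key n (i + 1) hi

/-- Before position `p`, the sequence `a` is the concatenation of blocks consisting of `m`
followed by a prefix of `a'` of length given by the ruler sequence composed with `t`. -/
structure RuledBefore (a a' t : ℕ → ℕ) (b m p : ℕ) : Prop where
  head : ∀ n, blockStart b t n < p → a (blockStart b t n) = m
  tail : ∀ n i, i < t (multiplicity b (n + 1)) → blockStart b t n + 1 + i < p →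
    a (blockStart b t n + 1 + i) = a' i

theorem multiplicity_mul_pow_add {b j s i : ℕ} (hb : 2 ≤ b) (hi : 0 < i) (hij : i < b ^ j) :
    multiplicity b (s * b ^ j + i) = multiplicity b i := by
  induction j generalizing i with
  | zero => simp at hij; omega
  | succ j ih =>
    have e : s * b ^ (j + 1) = b * (s * b ^ j) := by ring
    by_cases hd : b ∣ i
    · obtain ⟨i, rfl⟩ := hd
      have hi' : 0 < i := Nat.pos_of_mul_pos_left hi
      rw [e, ← mul_add, multiplicity_base_mul hb (by omega), multiplicity_base_mul hb hi',
        ih hi' (Nat.lt_of_mul_lt_mul_left (a := b) (by rwa [pow_succ'] at hij))]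
    · rw [multiplicity_eq_zero.mpr hd, multiplicity_eq_zero, e]
      rwa [Nat.dvd_add_right (dvd_mul_right _ _)]

theorem multiplicity_add_pow {b j i : ℕ} (hb : 2 ≤ b) (hi : 0 < i)
    (hij : i + b ^ j < b ^ (j + 1)) : multiplicity b (i + b ^ j) = multiplicity b i := by
  induction j generalizing i with
  | zero =>
    simp only [pow_zero, zero_add, pow_one] at hij
    rw [pow_zero, multiplicity_eq_zero.mpr (Nat.not_dvd_of_pos_of_lt (by omega) hij),
      multiplicity_eq_zero.mpr (Nat.not_dvd_of_pos_of_lt hi (by omega))]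
  | succ j ih =>
    rw [pow_succ' b j]
    by_cases hd : b ∣ i
    · obtain ⟨i, rfl⟩ := hd
      have hi' : 0 < i := Nat.pos_of_mul_pos_left hi
      rw [← mul_add, multiplicity_base_mul hb (by omega), multiplicity_base_mul hb hi',
        ih hi' (Nat.lt_of_mul_lt_mul_left (a := b)
          (by rwa [pow_succ' b (j + 1), pow_succ' b j, ← mul_add, ← pow_succ' b j] at hij))]
    · rw [multiplicity_eq_zero.mpr hd, multiplicity_eq_zero]
      rwa [Nat.dvd_add_left (dvd_mul_right _ _)]

theorem multiplicity_pred_mul_pow {b j : ℕ} (hb : 2 ≤ b) :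
    multiplicity b ((b - 1) * b ^ j) = j := by
  induction j with
  | zero =>
    rw [pow_zero, mul_one, multiplicity_eq_zero]
    exact Nat.not_dvd_of_pos_of_lt (by omega) (by omega)
  | succ j ih =>
    rw [pow_succ', mul_left_comm, multiplicity_base_mul hb, ih]
    exact Nat.mul_pos (by omega) (by positivity)

section Ruled

variable {a a' t : ℕ → ℕ} {b m p n l y k c : ℕ}

theorem RuledBefore.eq_iff (h : RuledBefore a a' t b m p) (ha' : ∀ i, m < a' i) {q : ℕ}
    (hq : q < p) : a q = m ↔ ∃ n, blockStart b t n = q := by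
  constructor
  · intro hm
    obtain ⟨n, rfl | ⟨i, hi, rfl⟩⟩ := exists_block b t q
    · exact ⟨n, rfl⟩
    · rw [h.tail n i hi hq] at hm
      exact absurd hm (ha' i).ne'
  · rintro ⟨n, rfl⟩
    exact h.head n hq

/-- A power whose root contains `m` and which ends in the block `n` shifts the start of this block
by a whole number `c` of blocks. -/
theorem RuledBefore.exists_shift (h : RuledBefore a a' t b m (blockStart b t n + 1 + l))
    (ha' : ∀ i, m < a' i) (hl : l ≤ t (multiplicity b (n + 1)))
    (hE : EndsInPower a (blockStart b t n + 1 + l) y k) (hk : 2 ≤ k) (hly : l < y) :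
    ∃ c, 1 ≤ c ∧ c ≤ n ∧ blockStart b t (n - c) + y = blockStart b t n ∧
      l ≤ t (multiplicity b (n - c + 1)) := by
  obtain ⟨hy, hp, hper⟩ := hE
  have h2 : 2 * y ≤ k * y := Nat.mul_le_mul_right y hk
  have hmono := blockStart_strictMono b t
  have e : a (blockStart b t n - y) = m := by
    rw [hper _ (by omega) (by omega), Nat.sub_add_cancel (by omega)]
    exact h.head n (by omega)
  obtain ⟨j, hj⟩ := (h.eq_iff ha' (by omega)).mp e
  have hjn : j < n := hmono.lt_iff_lt.mp (by omega)
  refine ⟨n - j, by omega, by omega, ?_, ?_⟩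
  · rw [Nat.sub_sub_self hjn.le]; omega
  · rw [Nat.sub_sub_self hjn.le]
    by_contra! hlt
    have hle : blockStart b t (j + 1) ≤ blockStart b t n := hmono.monotone hjn
    have hs : blockStart b t (j + 1) = blockStart b t j + 1 + t (multiplicity b (j + 1)) := rfl
    have hm := h.head (j + 1) (by omega)
    rw [hper _ (by omega) (by omega), hs,
      show blockStart b t j + 1 + t (multiplicity b (j + 1)) + y =
        blockStart b t n + 1 + t (multiplicity b (j + 1)) by omega,
      h.tail n _ (by omega) (by omega)] at hm
    exact (ha' _).ne' hm

theorem periodicBefore_of_blockStart (ht : StrictMono t) {K : ℕ} (hc : 1 ≤ c)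
    (h : K * c ≤ n ∧ ∀ z, n ≤ z + K * c → z + c ≤ n →
      blockStart b t (z + c) = blockStart b t z + y) : PeriodicBefore b (n + 1) c K := by
  refine ⟨hc, by omega, fun z hz hzc => ?_⟩
  obtain ⟨z, rfl⟩ : ∃ w, z = w + 1 := ⟨z - 1, by omega⟩
  have h1 := h.2 z (by omega) (by omega)
  have h2 := h.2 (z + 1) (by omega) (by omega)
  rw [add_right_comm z 1 c] at h2 ⊢
  simp only [blockStart] at h2
  exact ht.injective (by omega)

theorem RuledBefore.periodicBefore (h : RuledBefore a a' t b m (blockStart b t n + 1 + l))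
    (ha' : ∀ i, m < a' i) (ht : StrictMono t)
    (hE : EndsInPower a (blockStart b t n + 1 + l) y k) (hk : 1 ≤ k) (hly : l < y)
    (hc : 1 ≤ c) (hcn : c ≤ n) (hcy : blockStart b t (n - c) + y = blockStart b t n) :
    PeriodicBefore b (n + 1) c (k - 1) := by
  obtain ⟨hy, hp, hper⟩ := hE
  obtain ⟨k, rfl⟩ : ∃ j, k = j + 1 := ⟨k - 1, by omega⟩
  have e : (k + 1) * y = k * y + y := by ring
  refine periodicBefore_of_blockStart ht hc (y := y) ?_
  exact mark_add_of_periodic (lo := blockStart b t n + 1 + l - (k + 1) * y)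
    (blockStart_strictMono b t) rfl (fun q hq => h.eq_iff ha' (by omega)) hcn hcy
    (fun i hi hi' => hper i (by omega) (by omega)) (by rw [Nat.add_sub_cancel]; omega)

theorem RuledBefore.periodicBefore_of_eq (h : RuledBefore a a' t b m (blockStart b t (n + 1)))
    (ha' : ∀ i, m < a' i) (ht : StrictMono t)
    (hE : EndsInPower a (blockStart b t (n + 1)) y k)
    (hc : 1 ≤ c) (hcn : c ≤ n) (hcy : blockStart b t (n - c) + y = blockStart b t n)
    (heq : multiplicity b (n - c + 1) = multiplicity b (n + 1)) :
    PeriodicBefore b (n + 2) c k := by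
  obtain ⟨hy, hp, hper⟩ := hE
  refine periodicBefore_of_blockStart ht hc (y := y) ?_
  refine mark_add_of_periodic (lo := blockStart b t (n + 1) - k * y)
    (blockStart_strictMono b t) rfl (fun q hq => h.eq_iff ha' hq) (by omega) ?_
    (fun i hi hi' => hper i (by omega) hi') (by omega)
  rw [show n + 1 - c = n - c + 1 by omega]
  simp only [blockStart, heq]
  omega

/-- A square ending at the end of a block whose tail is shorter than the one `c` blocks before it
yields a square at the end of this longer tail. -/
theorem RuledBefore.square_of_lt (hb : 2 ≤ b)
    (h : RuledBefore a a' t b m (blockStart b t (n + 1)))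
    (ha' : ∀ i, m < a' i) (ht : StrictMono t)
    (hE : EndsInPower a (blockStart b t (n + 1)) y 2)
    (hc : 1 ≤ c) (hcn : c ≤ n) (hcy : blockStart b t (n - c) + y = blockStart b t n)
    (hlt : multiplicity b (n + 1) < multiplicity b (n - c + 1)) :
    ∃ r, 1 ≤ r ∧ r ≤ t (multiplicity b (n + 1)) ∧
      EndsInPower a' (t (multiplicity b (n - c + 1))) r 2 := by
  obtain ⟨hy, hp, hper⟩ := hE
  have hmono := blockStart_strictMono b t
  have htl := ht hlt
  have hs : ∀ j, blockStart b t (j + 1) = blockStart b t j + 1 + t (multiplicity b (j + 1)) :=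
    fun _ => rfl
  have hsn := hs n
  have hsc := hs (n - c)
  have hle : blockStart b t (n - c + 1) ≤ blockStart b t n := hmono.monotone (by omega)
  obtain ⟨h1, h2⟩ := mark_sub_add (n := n) (lo := blockStart b t (n + 1) - 2 * y) hmono rfl
    (fun q hq => h.eq_iff ha' (by omega)) hcn hcy
    (fun i hi hi' => hper i (by omega) (by omega)) (c - 1) (by omega)
    (by rw [show n - (c - 1) = n - c + 1 by omega]; omega)
  rw [show n - (c - 1) = n - c + 1 by omega] at h1 h2
  obtain ⟨w, hw⟩ : ∃ w, n = 2 * c + w := by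
    refine ⟨n - 2 * c, ?_⟩
    by_contra hne
    have : n - c + 1 - c = 0 := by omega
    rw [this, blockStart] at h2
    omega
  rw [show n - c + 1 - c = w + 1 by omega] at h2
  have hmul : multiplicity b (w + 1) = multiplicity b (n + 1) := by
    have := multiplicity_sub_two_mul hb (c := c) (x := n + 1) (by omega)
      (by rwa [show n + 1 - c = n - c + 1 by omega])
    rwa [show n + 1 - 2 * c = w + 1 by omega] at this
  have hsw := hs w
  rw [hmul] at hsw
  set l := t (multiplicity b (n + 1))
  set L := t (multiplicity b (n - c + 1))
  have hr : L - l ≤ l := by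
    by_contra! hgt
    have hm := h.head w (by omega)
    rw [hper _ (by omega) (by omega),
      show blockStart b t w + y = blockStart b t (n - c) + 1 + (L - l - 1) by omega,
      h.tail _ _ (by omega) (by omega)] at hm
    exact (ha' _).ne' hm
  refine ⟨L - l, by omega, hr, by omega, by omega, fun i hi hi' => ?_⟩
  have e1 := h.tail w i (by rw [hmul]; omega) (by omega)
  have e2 := h.tail (n - c) (i + (L - l)) (by omega) (by omega)
  rw [← e1, ← e2, hper _ (by omega) (by omega)]
  congr 1
  omega

theorem RuledBefore.endsInPower_tail (h : RuledBefore a a' t b m (blockStart b t n + 1 + l))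
    (ha' : ∀ i, m < a' i) (hl : l ≤ t (multiplicity b (n + 1)))
    (hE : EndsInPower a (blockStart b t n + 1 + l) y k) (hly : y ≤ l) :
    EndsInPower a' l y k := by
  obtain ⟨hy, hp, hper⟩ := hE
  have hkl : k * y ≤ l := by
    by_contra! hlt
    have hm := h.head n (by omega)
    rw [hper _ (by omega) (by omega),
      show blockStart b t n + y = blockStart b t n + 1 + (y - 1) by omega,
      h.tail _ _ (by omega) (by omega)] at hm
    exact (ha' _).ne' hm
  refine ⟨hy, hkl, fun i hi hi' => ?_⟩
  rw [← h.tail n i (by omega) (by omega), ← h.tail n (i + y) (by omega) (by omega),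
    hper _ (by omega) (by omega)]
  congr 1
  omega

theorem RuledBefore.power_le_base (hb : 2 ≤ b)
    (h : RuledBefore a a' t b m (blockStart b t n + 1 + l))
    (ha' : ∀ i, m < a' i) (ht : StrictMono t) (hl : l ≤ t (multiplicity b (n + 1)))
    (hE : EndsInPower a (blockStart b t n + 1 + l) y k) (hly : l < y) : k ≤ b := by
  by_contra! hk
  obtain ⟨c, hc, hcn, hcy, -⟩ := h.exists_shift ha' hl hE (by omega) hly
  have := ((h.periodicBefore ha' ht hE (by omega) hly hc hcn hcy).lt_base hb (by omega)).1
  omega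

/-- A power with large exponent and with root containing `m` that ends at the end of a block
forces a digit `b - 1` in the block number, or a square at the end of a longer tail. -/
theorem RuledBefore.power_at_end (hb : 2 ≤ b)
    (h : RuledBefore a a' t b m (blockStart b t (n + 1)))
    (ha' : ∀ i, m < a' i) (ht : StrictMono t)
    (hE : EndsInPower a (blockStart b t (n + 1)) y k) (hk : 2 ≤ k)
    (hly : t (multiplicity b (n + 1)) < y) :
    (k < b ∧ (b ≤ k + 1 → ∃ i, (n + 1) / b ^ i % b = b - 1)) ∨
    (k = 2 ∧ ∃ r j, 1 ≤ r ∧ r ≤ t (multiplicity b (n + 1)) ∧ EndsInPower a' (t j) r 2) := by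
  obtain ⟨c, hc, hcn, hcy, hle⟩ := RuledBefore.exists_shift h ha' le_rfl hE hk hly
  rcases (ht.le_iff_le.mp hle).eq_or_lt with heq | hlt
  · exact Or.inl ((h.periodicBefore_of_eq ha' ht hE hc hcn hcy heq.symm).lt_base hb hk)
  · rcases hk.eq_or_lt with rfl | hk3
    · obtain ⟨r, h1, h2, h3⟩ := h.square_of_lt hb ha' ht hE hc hcn hcy hlt
      exact Or.inr ⟨rfl, r, _, h1, h2, h3⟩
    · have := (RuledBefore.periodicBefore h ha' ht hE (by omega) hly hc hcn hcy).multiplicity_le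
        hb (by omega)
      rw [show n + 1 - c = n - c + 1 by omega] at this
      omega

/-- Inside a tail of index `v`, at the end of the tail of index `j < v`, there is a `b`-th power. -/
theorem RuledBefore.endsInPower_base (hb : 2 ≤ b) {j : ℕ} (ht : StrictMono t)
    (hj : j < multiplicity b (n + 1))
    (h : RuledBefore a a' t b m (blockStart b t n + 1 + t j)) :
    ∃ y, EndsInPower a (blockStart b t n + 1 + t j) y b := by
  have hmono := blockStart_strictMono b t
  obtain ⟨s', hs'⟩ : b ^ (j + 1) ∣ n + 1 := pow_dvd_of_le_multiplicity hj
  obtain ⟨s, rfl⟩ : ∃ s, s' = s + 1 := by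
    rcases s' with _ | s'
    · omega
    · exact ⟨s', rfl⟩
  have hval : ∀ i, i + 1 < b ^ (j + 1) →
      multiplicity b (s * b ^ (j + 1) + i + 1) = multiplicity b (i + 1) :=
    fun i hi => by rw [add_assoc]; exact multiplicity_mul_pow_add hb (by omega) hi
  have hadd : ∀ i, i + 1 + b ^ j < b ^ (j + 1) →
      multiplicity b (i + 1 + b ^ j) = multiplicity b (i + 1) :=
    fun i hi => multiplicity_add_pow hb (by omega) hi
  have hlast := multiplicity_pred_mul_pow (j := j) hb
  have hn : n + 1 = s * b ^ (j + 1) + b ^ (j + 1) := by rw [hs']; ring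
  have hD : b ^ (j + 1) = (b - 1) * b ^ j + b ^ j := by
    obtain ⟨d, rfl⟩ : ∃ d, b = d + 1 := ⟨b - 1, by omega⟩
    rw [Nat.add_sub_cancel, pow_succ]; ring
  have hc : 0 < b ^ j := by positivity
  have hbc : b ^ j ≤ (b - 1) * b ^ j := Nat.le_mul_of_pos_left _ (by omega)
  set D := b ^ (j + 1)
  set c := b ^ j
  set o := s * D
  set P := blockStart b t
  have hs : ∀ i, P (i + 1) = P i + 1 + t (multiplicity b (i + 1)) := fun _ => rfl
  obtain ⟨y, hy⟩ : ∃ y, P (o + c) = P o + y :=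
    ⟨P (o + c) - P o, by have := hmono.monotone (Nat.le_add_right o c); omega⟩
  have hy1 : 1 ≤ y := by
    have := hmono (Nat.lt_add_of_pos_right (n := o) hc)
    omega
  have hshift : ∀ z, z + c < D → P (o + z + c) = P (o + z) + y := by
    intro z
    induction z with
    | zero => intro _; exact hy
    | succ z ih =>
      intro hz
      have h1 := ih (by omega)
      have h2 := hs (o + z)
      have h3 := hs (o + z + c)
      rw [hval z (by omega)] at h2
      rw [show o + z + c + 1 = o + (z + c) + 1 by ring, hval (z + c) (by omega),
        show z + c + 1 = z + 1 + c by ring, hadd z (by omega)] at h3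
      rw [show o + (z + 1) + c = o + (z + c) + 1 by ring,
        show o + (z + 1) = o + z + 1 by ring]
      omega
  have hmul : ∀ q, q < b → P (o + q * c) = P o + q * y := by
    intro q
    induction q with
    | zero => simp
    | succ q ih =>
      intro hq
      have h1 : (q + 1) * c ≤ (b - 1) * c := Nat.mul_le_mul_right c (by omega)
      have h2 : (q + 1) * c = q * c + c := by ring
      rw [h2, ← add_assoc, hshift _ (by omega), ih (by omega)]
      ring
  have hvl : multiplicity b (o + ((b - 1) * c - 1) + 1) = j := by
    rw [hval _ (by omega), Nat.sub_add_cancel (by omega), hlast]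
  have hend : P n + 1 + t j = P (o + (b - 1) * c) + y := by
    have h1 := hshift ((b - 1) * c - 1) (by omega)
    have h2 := hs (o + ((b - 1) * c - 1))
    rw [hvl, show o + ((b - 1) * c - 1) + 1 = o + (b - 1) * c by omega] at h2
    rw [show o + ((b - 1) * c - 1) + c = n by omega] at h1
    omega
  have hby : b * y = (b - 1) * y + y := by
    obtain ⟨d, rfl⟩ : ∃ d, b = d + 1 := ⟨b - 1, by omega⟩
    rw [Nat.add_sub_cancel]; ring
  have hstart : P n + 1 + t j = P o + b * y := by
    rw [hend, hmul (b - 1) (by omega)]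
    omega
  refine ⟨y, hy1, by omega, fun i hi hi' => ?_⟩
  have hw : ∀ w, P w ≤ i → i < P (w + 1) →
      ∃ z, w = o + z ∧ z + c < D ∧ P (w + c) = P w + y := by
    intro w h1 h2
    have h3 : o < w + 1 := hmono.lt_iff_lt.mp (show P o < P (w + 1) by omega)
    have h4 : w < o + (b - 1) * c :=
      hmono.lt_iff_lt.mp (show P w < P (o + (b - 1) * c) by omega)
    refine ⟨w - o, by omega, by omega, ?_⟩
    have := hshift (w - o) (by omega)
    rwa [show o + (w - o) = w by omega] at this
  have hblock : ∃ w, i = P w ∨ ∃ i' < t (multiplicity b (w + 1)), i = P w + 1 + i' :=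
    exists_block b t i
  have hhead : ∀ w, P w < P n + 1 + t j → a (P w) = m := h.head
  have htail : ∀ w i, i < t (multiplicity b (w + 1)) → P w + 1 + i < P n + 1 + t j →
      a (P w + 1 + i) = a' i := h.tail
  obtain ⟨w, rfl | ⟨i', hi1, rfl⟩⟩ := hblock
  · obtain ⟨z, -, -, h3⟩ := hw w le_rfl (hmono w.lt_succ_self)
    rw [hhead w (by omega), ← h3, hhead _ (by omega)]
  · obtain ⟨z, rfl, h2, h3⟩ := hw w (by omega) (by have := hs w; omega)
    have hlt : i' < t (multiplicity b (o + z + c + 1)) := by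
      rw [hval z (by omega)] at hi1
      by_cases hz : z + c + 1 = D
      · have e : z + 1 = (b - 1) * c := by omega
        rw [e, hlast] at hi1
        rw [show o + z + c + 1 = n + 1 by omega]
        exact hi1.trans (ht hj)
      · rw [show o + z + c + 1 = o + (z + c) + 1 by ring, hval (z + c) (by omega),
          show z + c + 1 = z + 1 + c by ring, hadd z (by omega)]
        exact hi1
    rw [htail _ i' hi1 (by omega), ← htail _ i' hlt (by omega)]
    congr 1
    omega

end Ruled

/-- The increasing enumeration (from `0`) of the lengths of the prefixes of `A^(m+1)` with curling
number at most `m`. -/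
noncomputable def lowLen (m j : ℕ) : ℕ := Nat.nth (fun k => curl (gPrefix (m + 1) k) ≤ m) j

theorem curl_nil : curl [] = 1 := by
  refine max_eq_left (csSup_le' ?_)
  rintro k ⟨X, Y, hY, h⟩
  have := congrArg List.length h
  have hY' := List.length_pos_iff.mpr hY
  simp only [List.length_nil, List.length_append, List.length_flatten, List.map_replicate,
    List.sum_replicate, smul_eq_mul] at this
  nlinarith

theorem lowLen_zero {m : ℕ} (hm : 1 ≤ m) : lowLen m 0 = 0 :=
  Nat.nth_zero_of_zero (p := fun k => curl (gPrefix (m + 1) k) ≤ m) (curl_nil.le.trans hm)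

theorem lt_gseq_succ (m i : ℕ) : m < gseq (m + 1) i :=
  (Nat.lt_succ_self m).trans_le (le_max_left _ _)

section Structure

variable (hSH : StandingHyp) {m : ℕ} (hm : 1 ≤ m)
include hSH hm

theorem lowLen_strictMono : StrictMono (lowLen m) :=
  Nat.nth_strictMono (hSH m hm).2

theorem curl_lowLen (j : ℕ) : curl (gPrefix (m + 1) (lowLen m j)) ≤ m :=
  Nat.nth_mem_of_infinite (hSH m hm).2 j

theorem curl_complete {n : ℕ} (h : RuledBefore (gseq m) (gseq (m + 1)) (lowLen m) (m + 1) m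
    (blockStart (m + 1) (lowLen m) (n + 1))) :
    curl (gPrefix m (blockStart (m + 1) (lowLen m) (n + 1))) ≤ m := by
  by_contra! hlt
  have hsq : ∀ j r, ¬ EndsInPower (gseq (m + 1)) (lowLen m j) r (m + 1) := fun j r hr =>
    (curl_lowLen hSH hm j).not_gt ((le_curl_gPrefix_iff (by omega)).mpr ⟨r, hr⟩)
  obtain ⟨y, hE⟩ := (le_curl_gPrefix_iff (k := m + 1) (by omega)).mp hlt
  rcases le_or_gt y (lowLen m (multiplicity (m + 1) (n + 1))) with hy | hy
  · exact hsq _ _ (RuledBefore.endsInPower_tail h (lt_gseq_succ m) le_rfl hE hy)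
  · rcases h.power_at_end (by omega) (lt_gseq_succ m) (lowLen_strictMono hSH hm) hE (by omega) hy
      with ⟨h1, -⟩ | ⟨h1, r, j, -, -, h2⟩
    · omega
    · exact hsq j r (h2.mono (by omega))

theorem gseq_tail {n l : ℕ} (hl : l < lowLen m (multiplicity (m + 1) (n + 1)))
    (h : RuledBefore (gseq m) (gseq (m + 1)) (lowLen m) (m + 1) m
      (blockStart (m + 1) (lowLen m) n + 1 + l)) :
    gseq m (blockStart (m + 1) (lowLen m) n + 1 + l) = gseq (m + 1) l := by
  have ht := lowLen_strictMono hSH hm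
  set p := blockStart (m + 1) (lowLen m) n + 1 + l with hp
  have hlow : m + 1 ≤ curl (gPrefix m p) ∨ m + 1 ≤ curl (gPrefix (m + 1) l) := by
    by_contra! hlt
    obtain ⟨j, hj⟩ : ∃ j, lowLen m j = l :=
      ⟨_, Nat.nth_count (p := fun k => curl (gPrefix (m + 1) k) ≤ m)
        (show curl (gPrefix (m + 1) l) ≤ m by omega)⟩
    subst hj
    obtain ⟨y, hy⟩ := h.endsInPower_base (by omega) ht (ht.lt_iff_lt.mp hl)
    have : m + 1 ≤ curl (gPrefix m p) := (le_curl_gPrefix_iff (by omega)).mpr ⟨y, hy⟩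
    omega
  have hup : curl (gPrefix m p) ≤ max (m + 1) (curl (gPrefix (m + 1) l)) := by
    by_contra! hlt
    obtain ⟨h1, h2⟩ := max_lt_iff.mp hlt
    obtain ⟨y, hE⟩ := (le_curl_gPrefix_iff (by omega)).mp (le_refl (curl (gPrefix m p)))
    rcases le_or_gt y l with hy | hy
    · have := (le_curl_gPrefix_iff (by omega)).mpr
        ⟨y, h.endsInPower_tail (lt_gseq_succ m) hl.le hE hy⟩
      omega
    · have := h.power_le_base (by omega) (lt_gseq_succ m) ht hl.le hE hy
      omega
  have hge : 2 ≤ curl (gPrefix (m + 1) l) → curl (gPrefix (m + 1) l) ≤ curl (gPrefix m p) := by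
    intro h2
    obtain ⟨y, hy, hyl, hper⟩ := (le_curl_gPrefix_iff h2).mp le_rfl
    refine (le_curl_gPrefix_iff h2).mpr ⟨y, hy, by omega, fun i hi hi' => ?_⟩
    obtain ⟨i, rfl⟩ : ∃ j, i = blockStart (m + 1) (lowLen m) n + 1 + j :=
      ⟨i - (blockStart (m + 1) (lowLen m) n + 1), by omega⟩
    rw [add_assoc _ i y, h.tail n i (by omega) (by omega),
      h.tail n (i + y) (by omega) (by omega), hper i (by omega) (by omega)]
  unfold gseq
  omega

/-- `A^(m)` is the concatenation of the strings `m T`, where the `T` in the `n`-th one is the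
prefix of `A^(m+1)` of length `lowLen m v`, with `v` the `(m+1)`-adic valuation of `n`. -/
theorem ruledBefore (p : ℕ) :
    RuledBefore (gseq m) (gseq (m + 1)) (lowLen m) (m + 1) m p := by
  induction p with
  | zero => exact ⟨fun n h => absurd h (Nat.not_lt_zero _), fun n i _ h => absurd h (by omega)⟩
  | succ p ih =>
    constructor
    · intro n hn
      rcases (Nat.lt_succ_iff.mp hn).lt_or_eq with h | rfl
      · exact ih.head n h
      · refine max_eq_left ?_
        obtain _ | n := n
        · exact (curl_nil.le.trans hm)
        · exact curl_complete hSH hm ih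
    · intro n i hi hn
      rcases (Nat.lt_succ_iff.mp hn).lt_or_eq with h | rfl
      · exact ih.tail n i hi h
      · exact gseq_tail hSH hm hi ih

theorem curl_good {n : ℕ} (hn : ¬ m + 2 ∣ n + 1)
    (hd : ∀ i, (n + 1) / (m + 2) ^ i % (m + 2) ≠ m + 1) :
    curl (gPrefix (m + 1) (blockStart (m + 2) (lowLen (m + 1)) n + 1)) ≤ m := by
  by_contra! hlt
  have ht := lowLen_strictMono hSH (m := m + 1) (by omega)
  have hv := multiplicity_eq_zero.mpr hn
  have h0 : lowLen (m + 1) 0 = 0 := lowLen_zero (by omega)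
  have hs : blockStart (m + 2) (lowLen (m + 1)) (n + 1) =
      blockStart (m + 2) (lowLen (m + 1)) n + 1 := by
    rw [blockStart, hv, h0, add_zero]
  rw [← hs] at hlt
  obtain ⟨y, hE⟩ := (le_curl_gPrefix_iff (k := m + 1) (by omega)).mp hlt
  rcases (ruledBefore hSH (m := m + 1) (by omega) _).power_at_end (b := m + 2) (by omega)
      (lt_gseq_succ (m + 1)) ht hE (by omega) (by rw [hv, h0]; exact hE.1)
      with ⟨-, h1⟩ | ⟨-, r, j, h1, h2, -⟩
  · obtain ⟨i, hi⟩ := h1 (by omega)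
    exact hd i hi
  · rw [hv, h0] at h2
    omega

end Structure

theorem chi_mul_add {b q d : ℕ} (hb : 2 ≤ b) (hd : d < b) :
    chi b (b * q + d) = (b + 1) * chi b q + d := by
  by_cases h : d ≠ 0 ∨ q ≠ 0
  · rw [chi, add_comm (b * q), Nat.digits_add b (by omega) d q hd h, Nat.ofDigits_cons, chi]
    ring
  · obtain ⟨rfl, rfl⟩ : d = 0 ∧ q = 0 := by omega
    simp [chi]

theorem chi_eq {b : ℕ} (hb : 2 ≤ b) (a : ℕ) : chi b a = (b + 1) * chi b (a / b) + a % b := by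
  rw [← chi_mul_add hb (Nat.mod_lt a (by omega)), Nat.div_add_mod]

theorem chi_strictMono {b : ℕ} (hb : 2 ≤ b) : StrictMono (chi b) := by
  intro a a' h
  induction a' using Nat.strong_induction_on generalizing a with
  | _ a' ih =>
    rw [chi_eq hb a, chi_eq hb a']
    have hr := Nat.mod_lt a (show 0 < b by omega)
    rcases (Nat.div_le_div_right (c := b) h.le).lt_or_eq with hq | hq
    · have := ih (a' / b) (Nat.div_lt_self (by omega) (by omega)) hq
      have := Nat.mul_le_mul_left (b + 1) this
      rw [Nat.mul_succ] at this
      omega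
    · have h1 := Nat.div_add_mod a b
      have h2 := Nat.div_add_mod a' b
      rw [hq] at h1 ⊢
      omega

theorem chi_le_sq {b : ℕ} (hb : 2 ≤ b) (a : ℕ) : chi b a ≤ a ^ 2 := by
  induction a using Nat.strong_induction_on with
  | _ a ih =>
    rcases Nat.eq_zero_or_pos a with rfl | ha
    · simp [chi]
    · rw [chi_eq hb a]
      have h := ih (a / b) (Nat.div_lt_self ha (by omega))
      have h1 := Nat.div_add_mod a b
      generalize a / b = q at *
      generalize a % b = d at *
      subst h1
      calc (b + 1) * chi b q + d ≤ (b + 1) * q ^ 2 + d ^ 2 :=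
            add_le_add (Nat.mul_le_mul_left _ h) (Nat.le_self_pow (by omega) d)
        _ ≤ b ^ 2 * q ^ 2 + d ^ 2 := by gcongr; nlinarith
        _ ≤ (b * q + d) ^ 2 := by nlinarith [Nat.zero_le (b * q * d)]

theorem chi_digit_ne {b : ℕ} (hb : 2 ≤ b) (a i : ℕ) : chi b a / (b + 1) ^ i % (b + 1) ≠ b := by
  have hr := Nat.mod_lt a (show 0 < b by omega)
  induction i generalizing a with
  | zero =>
    rw [pow_zero, Nat.div_one, chi_eq hb a, Nat.mul_add_mod, Nat.mod_eq_of_lt (by omega)]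
    omega
  | succ i ih =>
    rw [pow_succ', ← Nat.div_div_eq_div_mul, chi_eq hb a, Nat.mul_add_div (by omega),
      Nat.div_eq_of_lt (a := a % b) (by omega), add_zero]
    exact ih _ (Nat.mod_lt _ (by omega))

theorem blockStart_le {b : ℕ} (hb : 1 < b) {t : ℕ → ℕ} (ht : Monotone t) {k n : ℕ} (h : k ≤ n) :
    blockStart b t k ≤ k * (1 + t (Nat.log b n)) := by
  induction k with
  | zero => simp [blockStart]
  | succ k ih =>
    have hv : t (multiplicity b (k + 1)) ≤ t (Nat.log b n) :=
      ht (Nat.le_log_of_pow_le hb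
        ((Nat.le_of_dvd k.succ_pos (pow_multiplicity_dvd b (k + 1))).trans h))
    rw [blockStart, add_mul]
    have := ih (by omega)
    omega

theorem nth_le_of_strictMono {p : ℕ → Prop} {G : ℕ → ℕ}
    (hG : StrictMono G) (h : ∀ k, p (G k)) (k : ℕ) : Nat.nth p k ≤ G k := by
  induction k with
  | zero => exact Nat.nth_zero ▸ Nat.sInf_le (h 0)
  | succ k ih =>
    by_contra! hlt
    exact absurd (hG k.lt_succ_self) (((Nat.le_nth_of_lt_nth_succ hlt (h _)).trans ih).not_gt)

theorem four_mul_lt_three_pow (t : ℕ) : 4 * t * (t + 1) < 3 ^ (t + 1) := by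
  induction t with
  | zero => norm_num
  | succ t ih =>
    rcases Nat.eq_zero_or_pos t with rfl | h
    · norm_num
    · rw [pow_succ]
      nlinarith

section Growth

variable (hSH : StandingHyp)
include hSH

theorem lowLen_succ_le {m : ℕ} (hm : 1 ≤ m) (t : ℕ) :
    lowLen m (t + 1) ≤
      1 + 4 * t * (t + 1) * (1 + lowLen (m + 1) (Nat.log 3 (4 * t * (t + 1)))) := by
  have hb : 2 ≤ m + 1 := by omega
  have ht := lowLen_strictMono hSH (m := m + 1) (by omega)
  set x : ℕ → ℕ := fun t => chi (m + 1) (t + t / m + 1) with hx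
  have hxmono : StrictMono x := (chi_strictMono hb).comp fun i j hij => by
    have := Nat.div_le_div_right (c := m) hij.le
    show i + i / m + 1 < j + j / m + 1
    omega
  have hxpos : ∀ t, 0 < x t := fun t =>
    (Nat.zero_le _).trans_lt (chi_strictMono hb (Nat.succ_pos (t + t / m)))
  have hxdvd : ∀ t, ¬ m + 2 ∣ x t := fun t h => by
    have h1 : t + t / m + 1 = (m + 1) * (t / m) + (t % m + 1) := by
      linarith [Nat.div_add_mod t m]
    have h2 := Nat.mod_lt t hm
    rw [hx] at h
    simp only [h1] at h
    rw [chi_mul_add hb (by omega), Nat.dvd_add_right (Dvd.intro _ rfl)] at h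
    exact absurd (Nat.le_of_dvd (by omega) h) (by omega)
  set G : ℕ → ℕ := fun
    | 0 => 0
    | t + 1 => blockStart (m + 2) (lowLen (m + 1)) (x t - 1) + 1 with hG
  have hGmono : StrictMono G := strictMono_nat_of_lt_succ fun k => by
    cases k with
    | zero => exact Nat.succ_pos _
    | succ k =>
      refine Nat.succ_lt_succ (blockStart_strictMono _ _ ?_)
      exact Nat.sub_lt_sub_right (hxpos k) (hxmono k.lt_succ_self)
  have hGlow : ∀ k, curl (gPrefix (m + 1) (G k)) ≤ m := by
    rintro (_ | k)
    · exact curl_nil.le.trans hm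
    · have hs := Nat.sub_add_cancel (hxpos k)
      exact curl_good hSH hm (by rw [hs]; exact hxdvd k)
        (by rw [hs]; exact chi_digit_ne hb _)
  have hle : x t - 1 ≤ 4 * t * (t + 1) := by
    have h1 := chi_le_sq hb (t + t / m + 1)
    have h2 := Nat.div_le_self t m
    have h3 : (t + t / m + 1) ^ 2 ≤ (2 * t + 1) ^ 2 := Nat.pow_le_pow_left (by omega) 2
    refine Nat.sub_le_iff_le_add.mpr (h1.trans (h3.trans (le_of_eq ?_)))
    ring
  refine (nth_le_of_strictMono hGmono hGlow (t + 1)).trans ?_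
  rw [hG, add_comm 1]
  refine Nat.succ_le_succ ((blockStart_le (by omega) ht.monotone le_rfl).trans ?_)
  refine Nat.mul_le_mul hle (Nat.add_le_add_left (ht.monotone ?_) 1)
  exact (Nat.log_mono_right hle).trans (Nat.log_anti_left (by norm_num) (by omega))

theorem exists_lowLen_le (t : ℕ) : ∃ C, ∀ m, 1 ≤ m → lowLen m t ≤ C := by
  induction t using Nat.strong_induction_on with
  | _ t ih =>
    cases t with
    | zero => exact ⟨0, fun m hm => (lowLen_zero hm).le⟩
    | succ t =>
      have hl : Nat.log 3 (4 * t * (t + 1)) < t + 1 := by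
        rcases Nat.eq_zero_or_pos t with rfl | h
        · simp
        · exact Nat.log_lt_of_lt_pow (by positivity) (four_mul_lt_three_pow t)
      obtain ⟨C, hC⟩ := ih _ hl
      refine ⟨1 + 4 * t * (t + 1) * (1 + C), fun m hm => (lowLen_succ_le hSH hm t).trans ?_⟩
      gcongr
      exact hC _ (by omega)

theorem exists_lowLen_le_pow {ρ : ℝ} (h1 : 1 < ρ) (h3 : ρ ≤ 3) :
    ∃ C : ℝ, ∀ m, 1 ≤ m → ∀ t, (lowLen m t : ℝ) ≤ C * ρ ^ t := by
  choose U hU using exists_lowLen_le hSH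
  obtain ⟨t₀, ht₀⟩ : ∃ t₀ : ℕ, ∀ t ≥ t₀, 145 * (t : ℝ) ^ 4 ≤ ρ ^ t := by
    have := (tendsto_pow_const_div_const_pow_of_one_lt 4 h1).eventually
      (Iic_mem_nhds (show (0 : ℝ) < 1 / 145 by norm_num))
    obtain ⟨t₀, ht₀⟩ := eventually_atTop.mp this
    refine ⟨t₀, fun t ht => ?_⟩
    have := (div_le_iff₀ (pow_pos (by linarith) t)).mp (ht₀ t ht)
    linarith
  set C : ℝ := 1 + ∑ t ∈ Finset.range (t₀ + 2), (U t : ℝ) with hC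
  have hC1 : 1 ≤ C := le_add_of_nonneg_right (Finset.sum_nonneg fun _ _ => Nat.cast_nonneg _)
  refine ⟨C, fun m hm t => ?_⟩
  induction t using Nat.strong_induction_on generalizing m with
  | _ t ih =>
    rcases lt_or_ge t (t₀ + 2) with h | h
    · calc (lowLen m t : ℝ) ≤ U t := mod_cast hU t m hm
        _ ≤ ∑ t ∈ Finset.range (t₀ + 2), (U t : ℝ) :=
            Finset.single_le_sum (f := fun t => (U t : ℝ)) (fun _ _ => Nat.cast_nonneg _)
              (Finset.mem_range.mpr h)
        _ ≤ C := by linarith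
        _ ≤ C * ρ ^ t := le_mul_of_one_le_right (by linarith) (one_le_pow₀ h1.le)
    · obtain ⟨t, rfl⟩ : ∃ s, t = s + 1 := ⟨t - 1, by omega⟩
      have ht1 : 1 ≤ t := by omega
      set Q := 4 * t * (t + 1) with hQ
      have hQ0 : 0 < Q := by positivity
      have hl : Nat.log 3 Q < t + 1 :=
        Nat.log_lt_of_lt_pow hQ0.ne' (four_mul_lt_three_pow t)
      have hrec : (lowLen m (t + 1) : ℝ) ≤ 1 + Q * (1 + lowLen (m + 1) (Nat.log 3 Q)) :=
        mod_cast lowLen_succ_le hSH hm t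
      have hlow : (lowLen (m + 1) (Nat.log 3 Q) : ℝ) ≤ C * Q :=
        (ih _ hl (m + 1) (by omega)).trans <| mul_le_mul_of_nonneg_left
          ((pow_le_pow_left₀ (by linarith) h3 _).trans
            (mod_cast Nat.pow_log_le_self 3 hQ0.ne')) (by linarith)
      have hQt : (Q : ℝ) ≤ 8 * (t : ℝ) ^ 2 := by
        have : Q ≤ 8 * t ^ 2 := by rw [hQ]; nlinarith
        exact_mod_cast this
      have hQ1 : (1 : ℝ) ≤ Q := mod_cast hQ0
      have ht1' : (1 : ℝ) ≤ (t : ℝ) ^ 4 := one_le_pow₀ (mod_cast ht1)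
      calc (lowLen m (t + 1) : ℝ) ≤ 1 + Q * (1 + C * Q) :=
            hrec.trans (by gcongr)
        _ ≤ C * (1 + Q + Q ^ 2) := by nlinarith
        _ ≤ C * (145 * (t : ℝ) ^ 4) := by
            refine mul_le_mul_of_nonneg_left ?_ (by linarith)
            nlinarith [mul_le_mul hQt hQt (by linarith) (by positivity)]
        _ ≤ C * ρ ^ (t + 1) := by
            refine mul_le_mul_of_nonneg_left ((ht₀ t (by omega)).trans ?_) (by linarith)
            exact pow_le_pow_right₀ h1.le t.le_succ

end Growth

theorem sum_pow_multiplicity_le {b : ℕ} (hb : 2 ≤ b) {r : ℝ} (hr0 : 0 ≤ r) (hr : r < 2) (N : ℕ) :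
    ∑ y ∈ Finset.range N, r ^ multiplicity b (y + 1) ≤ (1 - r / 2)⁻¹ * N := by
  calc ∑ y ∈ Finset.range N, r ^ multiplicity b (y + 1)
      ≤ ∑ y ∈ Finset.range N, ∑ j ∈ Finset.range N, if b ^ j ∣ y + 1 then r ^ j else 0 := by
        refine Finset.sum_le_sum fun y hy => ?_
        have hlt : multiplicity b (y + 1) < y + 1 := (Nat.lt_pow_self (by omega)).trans_le
          (Nat.le_of_dvd y.succ_pos (pow_multiplicity_dvd b (y + 1)))
        have hy' := Finset.mem_range.mp hy
        calc r ^ multiplicity b (y + 1)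
            = if b ^ multiplicity b (y + 1) ∣ y + 1 then r ^ multiplicity b (y + 1) else 0 :=
              (if_pos (pow_multiplicity_dvd b (y + 1))).symm
          _ ≤ _ := Finset.single_le_sum (f := fun j => if b ^ j ∣ y + 1 then r ^ j else 0)
              (fun j _ => by positivity) (Finset.mem_range.mpr (by omega))
    _ = ∑ j ∈ Finset.range N, ((N / b ^ j : ℕ) : ℝ) * r ^ j := by
        rw [Finset.sum_comm]
        refine Finset.sum_congr rfl fun j _ => ?_
        rw [← Finset.sum_filter, Finset.sum_const, Nat.card_multiples, nsmul_eq_mul]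
    _ ≤ ∑ j ∈ Finset.range N, N * (r / 2) ^ j := by
        refine Finset.sum_le_sum fun j _ => ?_
        rw [div_pow, mul_div_left_comm, mul_comm]
        refine mul_le_mul_of_nonneg_left (Nat.cast_div_le.trans ?_) (by positivity)
        push_cast
        gcongr
        exact_mod_cast hb
    _ = N * ∑ j ∈ Finset.range N, (r / 2) ^ j := (Finset.mul_sum _ _ _).symm
    _ ≤ N * (1 - r / 2)⁻¹ := by
        refine mul_le_mul_of_nonneg_left ?_ N.cast_nonneg
        rw [← tsum_geometric_of_lt_one (by positivity) (by linarith)]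
        exact (summable_geometric_of_lt_one (by positivity) (by linarith)).sum_le_tsum _
          fun _ _ => by positivity
    _ = (1 - r / 2)⁻¹ * N := mul_comm _ _

theorem cube_mul_count_gseq_le (m n T : ℕ) :
    n ^ 3 * Nat.count (fun i => gseq m i = n) T ≤ T * (m + T) ^ 3 := by
  rcases Nat.eq_zero_or_pos (Nat.count (fun i => gseq m i = n) T) with h | h
  · rw [h]
    positivity
  · rw [Nat.count_eq_card_filter_range] at h
    obtain ⟨i, hi⟩ := Finset.card_pos.mp h
    obtain ⟨hi', rfl⟩ := Finset.mem_filter.mp hi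
    rw [Finset.mem_range] at hi'
    rw [mul_comm T]
    refine Nat.mul_le_mul (Nat.pow_le_pow_left ?_ 3) (Nat.count_le _)
    have := curl_gPrefix_le m i
    exact max_le (by omega) (by omega)

theorem cube_mul_count_blockStart_le (hSH : StandingHyp) {m n : ℕ} (hm : 1 ≤ m) (hn : m < n)
    (x : ℕ) :
    n ^ 3 * Nat.count (fun i => gseq m i = n) (blockStart (m + 1) (lowLen m) x) ≤
      ∑ y ∈ Finset.range x, lowLen m (multiplicity (m + 1) (y + 1)) *
        (m + 1 + lowLen m (multiplicity (m + 1) (y + 1))) ^ 3 := by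
  induction x with
  | zero => simp [blockStart]
  | succ x ih =>
    set v := multiplicity (m + 1) (x + 1) with hv
    have hR := ruledBefore hSH hm (blockStart (m + 1) (lowLen m) x + 1 + lowLen m v)
    have hhead : gseq m (blockStart (m + 1) (lowLen m) x) = m := hR.head x (by omega)
    have htail : Nat.count (fun i => gseq m (blockStart (m + 1) (lowLen m) x + 1 + i) = n)
        (lowLen m v) = Nat.count (fun i => gseq (m + 1) i = n) (lowLen m v) := by
      rw [Nat.count_eq_card_filter_range, Nat.count_eq_card_filter_range]
      congr 1
      refine Finset.filter_congr fun i hi => ?_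
      have hi' := Finset.mem_range.mp hi
      rw [hR.tail x i hi' (by omega)]
    rw [Finset.sum_range_succ, blockStart, Nat.count_add, Nat.count_succ, ← hv, htail,
      if_neg (by omega), add_zero, mul_add]
    exact add_le_add ih (cube_mul_count_gseq_le (m + 1) n _)

theorem exists_cube_mul_count_le (hSH : StandingHyp) {m : ℕ} (hm : 1 ≤ m) :
    ∃ K : ℝ, ∀ n, m < n → ∀ N : ℕ,
      (n : ℝ) ^ 3 * Nat.count (fun i => gseq m i = n) N ≤ K * N := by
  obtain ⟨C, hC⟩ := exists_lowLen_le_pow hSH (ρ := 11 / 10) (by norm_num) (by norm_num)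
  have hC0 : 0 ≤ C := by
    have := (Nat.cast_nonneg _).trans (hC 1 le_rfl 0)
    simpa using this
  have hlow : ∀ j, (lowLen m j : ℝ) * (m + 1 + lowLen m j) ^ 3 ≤
      C * (m + 1 + C) ^ 3 * ((11 / 10 : ℝ) ^ 4) ^ j := by
    intro j
    have h1 : (1 : ℝ) ≤ (11 / 10) ^ j := one_le_pow₀ (by norm_num)
    have h2 := hC m hm j
    calc (lowLen m j : ℝ) * (m + 1 + lowLen m j) ^ 3
        ≤ (C * (11 / 10) ^ j) * ((m + 1) * (11 / 10) ^ j + C * (11 / 10) ^ j) ^ 3 := by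
          gcongr
          exact le_mul_of_one_le_right (by positivity) h1
      _ = C * (m + 1 + C) ^ 3 * ((11 / 10 : ℝ) ^ 4) ^ j := by
          rw [← pow_mul, mul_comm 4 j, pow_mul]
          ring
  refine ⟨C * (m + 1 + C) ^ 3 * (1 - (11 / 10 : ℝ) ^ 4 / 2)⁻¹, fun n hn N => ?_⟩
  have hN : N ≤ blockStart (m + 1) (lowLen m) N := (blockStart_strictMono _ _).le_apply
  calc (n : ℝ) ^ 3 * Nat.count (fun i => gseq m i = n) N
      ≤ ∑ y ∈ Finset.range N, (lowLen m (multiplicity (m + 1) (y + 1)) : ℝ) *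
          (m + 1 + lowLen m (multiplicity (m + 1) (y + 1))) ^ 3 :=
        mod_cast (Nat.mul_le_mul_left _ (Nat.count_monotone _ hN)).trans
          (cube_mul_count_blockStart_le hSH hm hn N)
    _ ≤ ∑ y ∈ Finset.range N, C * (m + 1 + C) ^ 3 *
          ((11 / 10 : ℝ) ^ 4) ^ multiplicity (m + 1) (y + 1) :=
        Finset.sum_le_sum fun y _ => hlow _
    _ ≤ C * (m + 1 + C) ^ 3 * ((1 - (11 / 10 : ℝ) ^ 4 / 2)⁻¹ * N) := by
        rw [← Finset.mul_sum]
        exact mul_le_mul_of_nonneg_left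
          (sum_pow_multiplicity_le (by omega) (by positivity) (by norm_num) N) (by positivity)
    _ = _ := by ring

theorem hasSum_tendsto_of_dominated {f : ℕ → ℕ → ℝ} {g D : ℕ → ℝ} (hD : Summable D)
    (hf : ∀ k, Tendsto (fun N => f N k) atTop (nhds (g k))) (hfD : ∀ N k, ‖f N k‖ ≤ D k) :
    ∃ L, HasSum g L ∧ Tendsto (fun N => ∑' k, f N k) atTop (nhds L) := by
  have hg : Summable g := hD.of_norm_bounded fun k =>
    le_of_tendsto (hf k).norm (Eventually.of_forall fun N => hfD N k)
  exact ⟨_, hg.hasSum, tendsto_tsum_of_dominated_convergence hD hf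
    (Eventually.of_forall fun N => hfD N)⟩

theorem hasSum_mul_count {a : ℕ → ℕ} {m : ℕ} (ha : ∀ i, m ≤ a i) (w : ℕ → ℝ) (N : ℕ) :
    HasSum (fun k => w (m + k) * Nat.count (fun i => a i = m + k) N)
      (∑ i ∈ Finset.range N, w (a i)) := by
  have h : ∀ i ∈ Finset.range N,
      HasSum (fun k => if a i = m + k then w (m + k) else 0) (w (a i)) := by
    intro i _
    have hi : m + (a i - m) = a i := Nat.add_sub_of_le (ha i)
    have := hasSum_single (f := fun k => if a i = m + k then w (m + k) else 0) (a i - m)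
      fun k hk => if_neg (by omega)
    simpa [hi] using this
  convert hasSum_sum h using 2 with k
  rw [Nat.count_eq_card_filter_range, ← Finset.sum_filter, Finset.sum_const, nsmul_eq_mul,
    mul_comm]

theorem sum_Icc_one_eq_sum_range {M : Type*} [AddCommMonoid M] (f : ℕ → M) (N : ℕ) :
    ∑ i ∈ Finset.Icc 1 N, f i = ∑ i ∈ Finset.range N, f (i + 1) := by
  induction N with
  | zero => simp
  | succ N ih => rw [Finset.sum_Icc_succ_top (by omega), ih, Finset.sum_range_succ]

theorem card_filter_gij_eq_count (m n N : ℕ) :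
    ((Finset.Icc 1 N).filter (fun p => gij m p = n)).card =
      Nat.count (fun i => gseq m i = n) N := by
  rw [Nat.count_eq_card_filter_range, Finset.card_filter, Finset.card_filter,
    sum_Icc_one_eq_sum_range]
  rfl

/-- If each `n ≥ m` has asymptotic density `δ^(m)(n)` in `A^(m)`, then
`Σ_{n=m}^∞ δ^(m)(n) = 1`, the series `Σ_{n=m}^∞ n·δ^(m)(n)` converges, and `A^(m)` has a
mean value equal to it. -/
theorem statement18 (hSH : StandingHyp) (m : ℕ) (hm : 1 ≤ m) (δ : ℕ → ℝ)
    (hδ : ∀ n, m ≤ n →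
      Tendsto (fun N : ℕ =>
          (((Finset.Icc 1 N).filter (fun p => gij m p = n)).card : ℝ) / (N : ℝ))
        atTop (nhds (δ n))) :
    HasSum (fun k : ℕ => δ (m + k)) 1 ∧
    ∃ L : ℝ, HasSum (fun k : ℕ => ((m + k : ℕ) : ℝ) * δ (m + k)) L ∧
      Tendsto (fun N : ℕ => (∑ i ∈ Finset.Icc 1 N, (gij m i : ℝ)) / (N : ℝ))
        atTop (nhds L) := by
  simp only [card_filter_gij_eq_count] at hδ
  have hlim : ∀ k, Tendsto (fun N : ℕ => (Nat.count (fun i => gseq m i = m + k) N : ℝ) / N)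
      atTop (nhds (δ (m + k))) := fun k => hδ (m + k) (by omega)
  obtain ⟨K, hK⟩ := exists_cube_mul_count_le hSH hm
  have hK0 : 0 ≤ K := by
    have := hK (m + 1) (by omega) 1
    rw [Nat.cast_one, mul_one] at this
    exact le_trans (by positivity) this
  have hD : Summable fun k : ℕ => (K + m) * (1 / ((k + 1 : ℕ) : ℝ) ^ 2) :=
    ((summable_nat_add_iff 1).mpr
      (Real.summable_one_div_nat_pow.mpr one_lt_two)).mul_left _
  have hbound : ∀ N k : ℕ, ((m + k : ℕ) : ℝ) *
      ((Nat.count (fun i => gseq m i = m + k) N : ℝ) / N) ≤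
        (K + m) * (1 / ((k + 1 : ℕ) : ℝ) ^ 2) := by
    intro N k
    rcases Nat.eq_zero_or_pos k with rfl | hk
    · have : (Nat.count (fun i => gseq m i = m + 0) N : ℝ) / N ≤ 1 :=
        div_le_one_of_le₀ (mod_cast Nat.count_le _) N.cast_nonneg
      have := mul_le_mul_of_nonneg_left this m.cast_nonneg
      norm_num at this ⊢
      linarith
    · have hc : (Nat.count (fun i => gseq m i = m + k) N : ℝ) / N ≤
          K / ((m + k : ℕ) : ℝ) ^ 3 := by
        have hn : (0 : ℝ) < ((m + k : ℕ) : ℝ) ^ 3 := by positivity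
        refine div_le_of_le_mul₀ N.cast_nonneg (by positivity) ?_
        rw [div_mul_eq_mul_div, le_div_iff₀ hn, mul_comm]
        exact hK (m + k) (by omega) N
      calc ((m + k : ℕ) : ℝ) * ((Nat.count (fun i => gseq m i = m + k) N : ℝ) / N)
          ≤ ((m + k : ℕ) : ℝ) * (K / ((m + k : ℕ) : ℝ) ^ 3) := by gcongr
        _ = K * (1 / ((m + k : ℕ) : ℝ) ^ 2) := by
            have : ((m + k : ℕ) : ℝ) ≠ 0 := by positivity
            field_simp
        _ ≤ (K + m) * (1 / ((k + 1 : ℕ) : ℝ) ^ 2) := by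
            have hle : ((k + 1 : ℕ) : ℝ) ≤ (m + k : ℕ) := mod_cast (by omega)
            exact mul_le_mul (le_add_of_nonneg_right m.cast_nonneg)
              (one_div_le_one_div_of_le (by positivity) (pow_le_pow_left₀ (by positivity) hle 2))
              (by positivity) (by positivity)
  have hge : ∀ i, m ≤ gseq m i := fun i => le_max_left _ _
  constructor
  · obtain ⟨L, hL, hT⟩ := hasSum_tendsto_of_dominated hD hlim fun N k => by
      rw [Real.norm_of_nonneg (by positivity)]
      exact (le_mul_of_one_le_left (by positivity) (mod_cast by omega)).trans (hbound N k)
    have hone : Tendsto (fun N : ℕ =>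
        ∑' k, (Nat.count (fun i => gseq m i = m + k) N : ℝ) / N) atTop (nhds 1) := by
      refine tendsto_const_nhds.congr' ?_
      filter_upwards [eventually_gt_atTop 0] with N hN
      have h := (hasSum_mul_count hge (fun _ => 1) N).div_const (N : ℝ)
      have hN' : (N : ℝ) ≠ 0 := by positivity
      simp only [one_mul, Finset.sum_const, Finset.card_range, nsmul_eq_mul, mul_one,
        div_self hN'] at h
      exact h.tsum_eq.symm
    rwa [tendsto_nhds_unique hT hone] at hL
  · obtain ⟨L, hL, hT⟩ := hasSum_tendsto_of_dominated hD
      (fun k => (hlim k).const_mul ((m + k : ℕ) : ℝ)) fun N k => by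
        rw [Real.norm_of_nonneg (by positivity)]
        exact hbound N k
    refine ⟨L, hL, hT.congr fun N => ?_⟩
    have h := (hasSum_mul_count hge (fun n => (n : ℝ)) N).div_const (N : ℝ)
    simp only [mul_div_assoc] at h
    rw [h.tsum_eq, sum_Icc_one_eq_sum_range]
    rfl
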